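/- (Theorem 2, closed version) Let ℰ be a continuous signature and K a quasivariety of Hausdorff topological ℰ-algebras. Let X be a subspace of a topological space Y with inclusion map e : X → Y, and let (F(X), i_X) and (F(Y), i_Y) be free universal algebras of X and Y in K. Suppose that X is an HM-valued retract of Y and that HM(F(X)), with the Hartman–Mycielski topology and the pointwise operations inherited from F(X), belongs to K. Then the unique continuous homomorphism F(e) : F(X) → F(Y) with F(e) ∘ i_X = i_Y ∘ e is a closed topological embedding. -/

import Mathlib

open Set MeasureTheory Topology

universe u v

namespace HMPaper

abbrev I01 : Set ℝ := Set.Ico (0:ℝ) 1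

def IsStep {X : Type u} (f : I01 → X) : Prop :=
  ∃ (n : ℕ) (a : Fin (n + 1) → ℝ), a 0 = 0 ∧ a (Fin.last n) = 1 ∧ StrictMono a ∧
    ∀ (i : Fin n) (s t : I01), (s : ℝ) ∈ Set.Ico (a i.castSucc) (a i.succ) →
      (t : ℝ) ∈ Set.Ico (a i.castSucc) (a i.succ) → f s = f t

def HM (X : Type u) : Type u := {f : I01 → X // IsStep f}

theorem isStep_const {X : Type u} (x : X) : IsStep (fun _ : I01 => x) := by
  refine ⟨1, ![0, 1], rfl, rfl, ?_, fun i s t _ _ => rfl⟩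
  intro i j hij
  fin_cases i <;> fin_cases j <;> simp_all

def hmConst {X : Type u} (x : X) : HM X := ⟨fun _ => x, isStep_const x⟩

theorem isStep_comp {X : Type u} {Y : Type v} (p : X → Y) {f : I01 → X}
    (hf : IsStep f) : IsStep (fun t => p (f t)) := by
  obtain ⟨n, a, h0, h1, hm, hc⟩ := hf
  exact ⟨n, a, h0, h1, hm, fun i s t hs ht => congrArg p (hc i s t hs ht)⟩

def hmMap {X : Type u} {Y : Type v} (p : X → Y) (f : HM X) : HM Y :=
  ⟨fun t => p (f.1 t), isStep_comp p f.2⟩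

/-- The basic set `N(a,b,V,ε)` of the Hartman–Mycielski topology: all step functions `g`
with `λ {t ∈ [a,b) : g(t) ∉ V} < ε` (`λ` being Lebesgue measure). -/
def hmBasicSet {X : Type u} (a b : ℝ) (V : Set X) (ε : ℝ) : Set (HM X) :=
  {g : HM X | MeasureTheory.volume
    {t : ℝ | ∃ ht : t ∈ I01, t ∈ Set.Ico a b ∧ g.1 ⟨t, ht⟩ ∉ V} < ENNReal.ofReal ε}

/-- The neighborhood subbase of the Hartman–Mycielski topology at a step function `f`:
all sets `N(a,b,V,ε)` where `0 ≤ a < b ≤ 1`, `f` is constant on `[a,b)`, `V` is a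
neighborhood of `f(a)` and `ε > 0`. -/
def hmSubbasis {X : Type u} [TopologicalSpace X] (f : HM X) : Set (Set (HM X)) :=
  {S | ∃ (a b : ℝ) (ha : 0 ≤ a) (hab : a < b) (hb : b ≤ 1) (V : Set X) (ε : ℝ),
    0 < ε ∧
    (∀ s t : I01, (s : ℝ) ∈ Set.Ico a b → (t : ℝ) ∈ Set.Ico a b → f.1 s = f.1 t) ∧
    V ∈ nhds (f.1 ⟨a, ha, hab.trans_le hb⟩) ∧
    S = hmBasicSet a b V ε}

/-- The Hartman–Mycielski topology on `HM X`: the topology whose neighborhood filter at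
each `f` is generated by the neighborhood subbase `hmSubbasis f`. -/
instance hmTopologicalSpace (X : Type u) [TopologicalSpace X] : TopologicalSpace (HM X) :=
  TopologicalSpace.mkOfNhds fun f => Filter.generate (hmSubbasis f)

theorem exists_mem_cell {n : ℕ} (a : Fin (n + 1) → ℝ) (x : ℝ)
    (h0 : a 0 ≤ x) (h1 : x < a (Fin.last n)) :
    ∃ i : Fin n, a i.castSucc ≤ x ∧ x < a i.succ := by
  classical
  have hne : (Finset.univ.filter (fun i : Fin (n + 1) => a i ≤ x)).Nonempty :=
    ⟨0, by simpa using h0⟩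
  set M := (Finset.univ.filter (fun i : Fin (n + 1) => a i ≤ x)).max' hne with hM
  have hMle : a M ≤ x := by
    have := (Finset.univ.filter (fun i : Fin (n + 1) => a i ≤ x)).max'_mem hne
    simpa using this
  have hMne : M ≠ Fin.last n := by
    intro h
    rw [h] at hMle
    exact absurd h1 (not_lt.2 hMle)
  have hMlt : (M : ℕ) < n := by
    have := Fin.lt_last_iff_ne_last.2 hMne
    simpa [Fin.lt_def] using this
  refine ⟨⟨M, hMlt⟩, ?_, ?_⟩
  · have : (⟨M, hMlt⟩ : Fin n).castSucc = M := by
      simp [Fin.castSucc, Fin.ext_iff]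
    rw [this]; exact hMle
  · by_contra h
    push_neg at h
    have hmem : (⟨M, hMlt⟩ : Fin n).succ ∈
        Finset.univ.filter (fun i : Fin (n + 1) => a i ≤ x) := by
      simp only [Finset.mem_filter, Finset.mem_univ, true_and]
      exact h
    have hle := Finset.le_max' _ _ hmem
    rw [← hM] at hle
    have : (M : ℕ) + 1 ≤ (M : ℕ) := by
      simpa [Fin.le_def] using hle
    omega

theorem isStep_combine {X : Type u} {Y : Type v} {k : ℕ} (f : Fin k → I01 → X)
    (hf : ∀ i, IsStep (f i)) (g : (Fin k → X) → Y) :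
    IsStep (fun t => g (fun i => f i t)) := by
  classical
  choose n a h0 h1 hmono hconst using hf
  set D : Finset ℝ :=
    insert (0:ℝ) (insert 1 (Finset.univ.biUnion fun i : Fin k =>
      Finset.univ.image (a i))) with hD
  have h0D : (0:ℝ) ∈ D := by simp [hD]
  have h1D : (1:ℝ) ∈ D := by simp [hD]
  have hDmem : ∀ x ∈ D, 0 ≤ x ∧ x ≤ 1 := by
    intro x hx
    simp only [hD, Finset.mem_insert, Finset.mem_biUnion, Finset.mem_image,
      Finset.mem_univ, true_and] at hx
    rcases hx with rfl | rfl | ⟨i, j, rfl⟩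
    · norm_num
    · norm_num
    · constructor
      · have := (hmono i).monotone (Fin.zero_le j)
        rw [h0 i] at this; exact this
      · have := (hmono i).monotone (Fin.le_last j)
        rw [h1 i] at this; exact this
  obtain ⟨m, hm⟩ : ∃ m, D.card = m + 1 := by
    have : D.Nonempty := ⟨0, h0D⟩
    have := Finset.card_pos.2 this
    exact ⟨D.card - 1, by omega⟩
  set b : Fin (m + 1) → ℝ := fun j => ((D.orderIsoOfFin hm j : ℝ)) with hb
  have hbmono : StrictMono b := fun i j hij => by
    exact_mod_cast (D.orderIsoOfFin hm).strictMono hij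
  have hbD : ∀ j, b j ∈ D := fun j => (D.orderIsoOfFin hm j).2
  have hbsurj : ∀ x ∈ D, ∃ j, b j = x := by
    intro x hx
    obtain ⟨j, hj⟩ := (D.orderIsoOfFin hm).surjective ⟨x, hx⟩
    exact ⟨j, by rw [hb]; exact congrArg Subtype.val hj⟩
  have hb0 : b 0 = 0 := by
    obtain ⟨j, hj⟩ := hbsurj 0 h0D
    have h1' : b 0 ≤ b j := hbmono.monotone (Fin.zero_le j)
    rw [hj] at h1'
    exact le_antisymm h1' (hDmem _ (hbD 0)).1
  have hb1 : b (Fin.last m) = 1 := by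
    obtain ⟨j, hj⟩ := hbsurj 1 h1D
    have h1' : b j ≤ b (Fin.last m) := hbmono.monotone (Fin.le_last j)
    rw [hj] at h1'
    exact le_antisymm (hDmem _ (hbD _)).2 h1'
  have hcell : ∀ (j : Fin m) (x : ℝ), x ∈ D → b j.castSucc < x → x < b j.succ → False := by
    intro j x hx hlt hlt'
    obtain ⟨l, rfl⟩ := hbsurj x hx
    have h1' : j.castSucc < l := hbmono.lt_iff_lt.1 hlt
    have h2' : l < j.succ := hbmono.lt_iff_lt.1 hlt'
    rw [Fin.lt_def] at h1' h2'
    simp only [Fin.coe_castSucc, Fin.val_succ] at h1' h2'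
    omega
  refine ⟨m, b, hb0, hb1, hbmono, ?_⟩
  intro j s t hs ht
  refine congrArg g (funext fun i => ?_)
  have hs0 : a i 0 ≤ (s : ℝ) := by rw [h0 i]; exact s.2.1
  have hs1 : (s : ℝ) < a i (Fin.last (n i)) := by rw [h1 i]; exact s.2.2
  obtain ⟨idx, hidx1, hidx2⟩ := exists_mem_cell (a i) s hs0 hs1
  have hlowD : a i idx.castSucc ∈ D := by
    simp only [hD, Finset.mem_insert, Finset.mem_biUnion, Finset.mem_image,
      Finset.mem_univ, true_and]
    exact Or.inr (Or.inr ⟨i, idx.castSucc, rfl⟩)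
  have hupD : a i idx.succ ∈ D := by
    simp only [hD, Finset.mem_insert, Finset.mem_biUnion, Finset.mem_image,
      Finset.mem_univ, true_and]
    exact Or.inr (Or.inr ⟨i, idx.succ, rfl⟩)
  have hlow : a i idx.castSucc ≤ b j.castSucc := by
    by_contra h
    push_neg at h
    exact hcell j _ hlowD h (lt_of_le_of_lt hidx1 hs.2)
  have hup : b j.succ ≤ a i idx.succ := by
    by_contra h
    push_neg at h
    exact hcell j _ hupD (lt_of_le_of_lt hs.1 hidx2) h
  exact hconst i idx s t ⟨hidx1, hidx2⟩
    ⟨le_trans hlow ht.1, lt_of_lt_of_le ht.2 hup⟩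

/-! ### Universal topological algebras of continuous signature -/

/-- A topological `ℰ`-algebra (the algebraic data): a topological space together with
operations `eₙ : Eₙ × Xⁿ → X`.  Continuity of the operations is expressed by
`ContinuousOps`. -/
structure EAlg (E : ℕ → Type u) [∀ n, TopologicalSpace (E n)] : Type (u + 1) where
  carrier : Type u
  top : TopologicalSpace carrier
  ops : ∀ n : ℕ, E n × (Fin n → carrier) → carrier

attribute [instance] EAlg.top

variable {E : ℕ → Type u} [∀ n, TopologicalSpace (E n)]

/-- The algebraic operations of `A` are all continuous, i.e. `A` is a topological
`ℰ`-algebra in the sense of Choban. -/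
def ContinuousOps (A : EAlg E) : Prop := ∀ n : ℕ, Continuous (A.ops n)

/-- A homomorphism of `ℰ`-algebras. -/
def IsHom (A B : EAlg E) (h : A.carrier → B.carrier) : Prop :=
  ∀ (n : ℕ) (c : E n) (x : Fin n → A.carrier),
    h (A.ops n (c, x)) = B.ops n (c, fun i => h (x i))

/-- `(F, i)` is a free universal `ℰ`-algebra of the space `X` in the class `K`. -/
def IsFreeAlg (K : EAlg E → Prop) (X : Type u) [TopologicalSpace X]
    (F : EAlg E) (i : X → F.carrier) : Prop :=
  K F ∧ Continuous i ∧
    ∀ B : EAlg E, K B → ∀ f : X → B.carrier, Continuous f →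
      ∃! h : F.carrier → B.carrier,
        Continuous h ∧ IsHom F B h ∧ ∀ x, h (i x) = f x

/-- `S` is (the underlying set of) a subalgebra of `A`. -/
def IsSubalgebra (A : EAlg E) (S : Set A.carrier) : Prop :=
  ∀ (n : ℕ) (c : E n) (x : Fin n → A.carrier), (∀ i, x i ∈ S) → A.ops n (c, x) ∈ S

/-- The subalgebra of `A` on a closed-under-operations subset `S`, with the subspace
topology. -/
def Subalg (A : EAlg E) (S : Set A.carrier) (hS : IsSubalgebra A S) : EAlg E where
  carrier := S
  top := inferInstance
  ops := fun n p => ⟨A.ops n (p.1, fun i => (p.2 i : A.carrier)),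
    hS n p.1 _ fun i => (p.2 i).2⟩

/-- The Cartesian product of a family of `ℰ`-algebras, with the product topology and
pointwise operations. -/
def ProdAlg {ι : Type u} (A : ι → EAlg E) : EAlg E where
  carrier := ∀ i, (A i).carrier
  top := inferInstance
  ops := fun n p i => (A i).ops n (p.1, fun j => p.2 j i)

/-- A quasivariety: a class of `ℰ`-algebras closed under subalgebras and arbitrary
Cartesian products. -/
def IsQuasivariety (K : EAlg E → Prop) : Prop :=
  (∀ (A : EAlg E) (S : Set A.carrier) (hS : IsSubalgebra A S), K A → K (Subalg A S hS)) ∧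
  (∀ (ι : Type u) (A : ι → EAlg E), (∀ i, K (A i)) → K (ProdAlg A))

/-- A complete quasivariety: a quasivariety containing every completely regular
`ℰ`-algebra algebraically isomorphic to one of its members. -/
def IsCompleteQuasivariety (K : EAlg E → Prop) : Prop :=
  IsQuasivariety K ∧
  ∀ A B : EAlg E, K B → CompletelyRegularSpace A.carrier →
    (∃ h : A.carrier → B.carrier, Function.Bijective h ∧ IsHom A B h) → K A

/-- The pointwise operations on `HM X` induced from operations on `X`. -/
def hmOps {X : Type u} (e : ∀ n : ℕ, E n × (Fin n → X) → X) (n : ℕ)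
    (p : E n × (Fin n → HM X)) : HM X :=
  ⟨fun t => e n (p.1, fun i => (p.2 i).1 t),
    isStep_combine (fun i => (p.2 i).1) (fun i => (p.2 i).2) (fun v => e n (p.1, v))⟩

/-- The Hartman–Mycielski algebra `HM(A)` of an `ℰ`-algebra `A`: step functions with
the Hartman–Mycielski topology and pointwise operations. -/
def HMAlg (A : EAlg E) : EAlg E where
  carrier := HM A.carrier
  top := hmTopologicalSpace A.carrier
  ops := hmOps A.ops

/-- A stratifiable space: a regular space with a monotone stratification `G`. -/
def Stratifiable (X : Type u) [TopologicalSpace X] : Prop :=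
  RegularSpace X ∧
  ∃ G : ℕ → Set X → Set X,
    (∀ (n : ℕ) (H : Set X), IsClosed H → IsOpen (G n H) ∧ H ⊆ G n H) ∧
    (∀ H : Set X, IsClosed H → H = ⋂ n : ℕ, closure (G n H)) ∧
    (∀ (n : ℕ) (H K : Set X), IsClosed H → IsClosed K → H ⊆ K → G n H ⊆ G n K)

/-- The part of `[a, b)` on which a step function takes values outside `V`. -/
def hmBad {X : Type u} (a b : ℝ) (V : Set X) (g : HM X) : Set ℝ :=
  {t : ℝ | ∃ ht : t ∈ I01, t ∈ Set.Ico a b ∧ g.1 ⟨t, ht⟩ ∉ V}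

theorem mem_hmBasicSet {X : Type u} {a b : ℝ} {V : Set X} {ε : ℝ} {g : HM X} :
    g ∈ hmBasicSet a b V ε ↔ volume (hmBad a b V g) < ENNReal.ofReal ε := Iff.rfl

theorem mem_hmBasicSet_of_forall {X : Type u} {a b : ℝ} {V : Set X} {ε : ℝ} (hε : 0 < ε)
    {g : HM X} (h : ∀ t : I01, (t : ℝ) ∈ Set.Ico a b → g.1 t ∈ V) :
    g ∈ hmBasicSet a b V ε := by
  have hempty : hmBad a b V g = ∅ :=
    Set.eq_empty_of_forall_notMem fun t ⟨ht, htab, hbad⟩ => hbad (h ⟨t, ht⟩ htab)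
  simpa [mem_hmBasicSet, hempty] using hε

theorem mem_of_hmConst_mem_hmBasicSet {X : Type u} {a b : ℝ} (ha : 0 ≤ a) (hb : b ≤ 1)
    {V : Set X} {x : X} (h : hmConst x ∈ hmBasicSet a b V (b - a)) : x ∈ V := by
  by_contra hx
  have hfull : hmBad a b V (hmConst x) = Set.Ico a b := by
    ext t
    exact ⟨fun ⟨_, ht, _⟩ => ht, fun ht => ⟨⟨ha.trans ht.1, ht.2.trans_le hb⟩, ht, hx⟩⟩
  rw [mem_hmBasicSet, hfull, Real.volume_Ico] at h
  exact lt_irrefl _ h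

theorem IsStep.exists_right_const {X : Type u} {f : I01 → X} (hf : IsStep f) (s : I01) :
    ∃ b : ℝ, (s : ℝ) < b ∧ b ≤ 1 ∧ ∀ t : I01, (t : ℝ) ∈ Set.Ico (s : ℝ) b → f t = f s := by
  obtain ⟨n, c, h0, h1, hmono, hc⟩ := hf
  obtain ⟨i, hi, hi'⟩ := exists_mem_cell c s (h0.trans_le s.2.1) (s.2.2.trans_eq h1.symm)
  exact ⟨c i.succ, hi', (hmono.monotone (Fin.le_last _)).trans_eq h1,
    fun t ht => hc i t s ⟨hi.trans ht.1, ht.2⟩ ⟨hi, hi'⟩⟩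

theorem isOpen_hmBasicSet {X : Type u} [TopologicalSpace X] {a b : ℝ} (ha : 0 ≤ a) (hb : b ≤ 1)
    {W : Set X} (hW : IsOpen W) (ε : ℝ) : IsOpen (hmBasicSet a b W ε) := by
  classical
  change ∀ g ∈ hmBasicSet a b W ε, hmBasicSet a b W ε ∈ Filter.generate (hmSubbasis g)
  intro g hg
  rw [mem_hmBasicSet] at hg
  obtain ⟨n, c, h0, h1, hmono, hc⟩ := g.2
  obtain ⟨η, hη, hsum⟩ : ∃ η : ℝ, 0 < η ∧
      volume (hmBad a b W g) + n * ENNReal.ofReal η < ENNReal.ofReal ε := by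
    have hfin := hg.ne_top
    have hlt := (ENNReal.lt_ofReal_iff_toReal_lt hfin).1 hg
    set B := (volume (hmBad a b W g)).toReal with hB
    have hn : (0 : ℝ) < n + 1 := by positivity
    refine ⟨(ε - B) / (n + 1), div_pos (sub_pos.2 hlt) hn, ?_⟩
    have hη : 0 < (ε - B) / (n + 1) := div_pos (sub_pos.2 hlt) hn
    rw [← ENNReal.ofReal_toReal hfin, ← hB, ← ENNReal.ofReal_natCast,
      ← ENNReal.ofReal_mul (Nat.cast_nonneg n),
      ← ENNReal.ofReal_add ENNReal.toReal_nonneg (by positivity),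
      ENNReal.ofReal_lt_ofReal_iff_of_nonneg (add_nonneg ENNReal.toReal_nonneg (by positivity))]
    have : (n + 1) * ((ε - B) / (n + 1)) = ε - B := mul_div_cancel₀ _ hn.ne'
    linarith
  let l : Fin n → ℝ := fun i => max a (c i.castSucc)
  let u : Fin n → ℝ := fun i => min b (c i.succ)
  let P : Fin n → Prop := fun i => ∃ t : I01, (t : ℝ) ∈ Set.Ico (l i) (u i) ∧ g.1 t ∈ W
  have hconst : ∀ (i : Fin n) (s t : I01), (s : ℝ) ∈ Set.Ico (l i) (u i) →
      (t : ℝ) ∈ Set.Ico (l i) (u i) → g.1 s = g.1 t := fun i s t hs ht =>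
    hc i s t ⟨(le_max_right _ _).trans hs.1, hs.2.trans_le (min_le_right _ _)⟩
      ⟨(le_max_right _ _).trans ht.1, ht.2.trans_le (min_le_right _ _)⟩
  have hmem : (⋂ i, if P i then hmBasicSet (l i) (u i) W η else Set.univ) ∈
      Filter.generate (hmSubbasis g) := by
    refine Filter.iInter_mem.2 fun i => ?_
    split_ifs with hP
    · obtain ⟨t, ht, htW⟩ := hP
      have hl : 0 ≤ l i := ha.trans (le_max_left _ _)
      have hlu : l i < u i := ht.1.trans_lt ht.2
      have hu : u i ≤ 1 := (min_le_left _ _).trans hb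
      refine Filter.mem_generate_of_mem
        ⟨l i, u i, hl, hlu, hu, W, η, hη, hconst i, hW.mem_nhds ?_, rfl⟩
      rwa [hconst i ⟨l i, hl, hlu.trans_le hu⟩ t ⟨le_rfl, hlu⟩ ht]
    · exact Filter.univ_mem
  refine Filter.mem_of_superset hmem fun h hh => ?_
  rw [Set.mem_iInter] at hh
  have hsub : hmBad a b W h ⊆
      hmBad a b W g ∪ ⋃ i, if P i then hmBad (l i) (u i) W h else ∅ := by
    rintro t ⟨ht, htab, hbad⟩
    by_cases hgt : g.1 ⟨t, ht⟩ ∈ W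
    · obtain ⟨i, hi, hi'⟩ := exists_mem_cell c t (h0.trans_le ht.1) (ht.2.trans_eq h1.symm)
      have hti : t ∈ Set.Ico (l i) (u i) := ⟨max_le htab.1 hi, lt_min htab.2 hi'⟩
      refine Or.inr (Set.mem_iUnion.2 ⟨i, ?_⟩)
      rw [if_pos (show P i from ⟨⟨t, ht⟩, hti, hgt⟩)]
      exact ⟨ht, hti, hbad⟩
    · exact Or.inl ⟨ht, htab, hgt⟩
  have hle : ∀ i, volume (if P i then hmBad (l i) (u i) W h else ∅) ≤ ENNReal.ofReal η := by
    intro i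
    have hi := hh i
    split_ifs at hi ⊢
    · exact le_of_lt hi
    · simp
  rw [mem_hmBasicSet]
  calc volume (hmBad a b W h)
      ≤ volume (hmBad a b W g) +
          volume (⋃ i, if P i then hmBad (l i) (u i) W h else ∅) :=
        (measure_mono hsub).trans (measure_union_le _ _)
    _ ≤ volume (hmBad a b W g) + n * ENNReal.ofReal η := by
        gcongr
        refine (measure_iUnion_fintype_le _ _).trans ((Finset.sum_le_sum fun i _ => hle i).trans ?_)
        simp
    _ < ENNReal.ofReal ε := hsum

theorem continuous_to_hm {Z : Type v} [TopologicalSpace Z] {X : Type u} [TopologicalSpace X]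
    {φ : Z → HM X}
    (h : ∀ (a b : ℝ) (W : Set X) (ε : ℝ), 0 ≤ a → b ≤ 1 → IsOpen W →
      IsOpen (φ ⁻¹' hmBasicSet a b W ε)) : Continuous φ := by
  refine continuous_def.2 fun U hU => isOpen_iff_mem_nhds.2 fun z hz => ?_
  have hUz : U ∈ Filter.generate (hmSubbasis (φ z)) := hU (φ z) hz
  suffices hle : Filter.map φ (nhds z) ≤ Filter.generate (hmSubbasis (φ z)) from hle hUz
  refine Filter.le_generate_iff.2 ?_
  rintro S ⟨a, b, ha, hab, hb, V, ε, hε, hconst, hV, rfl⟩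
  obtain ⟨W, hWV, hW, hmW⟩ := mem_nhds_iff.1 hV
  have hz : φ z ∈ hmBasicSet a b W ε := mem_hmBasicSet_of_forall hε fun t ht => by
    rwa [hconst t ⟨a, ha, hab.trans_le hb⟩ ht ⟨le_rfl, hab⟩]
  refine Filter.mem_of_superset ((h a b W ε ha hb hW).mem_nhds hz) fun y hy => ?_
  refine lt_of_le_of_lt (measure_mono ?_) hy
  rintro t ⟨ht, htab, hbad⟩
  exact ⟨ht, htab, fun hw => hbad (hWV hw)⟩

theorem continuous_hmMap {X : Type u} {Y : Type v} [TopologicalSpace X] [TopologicalSpace Y]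
    {p : X → Y} (hp : Continuous p) : Continuous (hmMap p) :=
  continuous_to_hm fun _ _ _ ε ha hb hW => isOpen_hmBasicSet ha hb (hW.preimage hp) ε

theorem continuous_hmConst {X : Type u} [TopologicalSpace X] :
    Continuous (hmConst : X → HM X) := by
  refine continuous_to_hm fun a b W ε _ _ hW => isOpen_iff_mem_nhds.2 fun x hx => ?_
  have hmono : ∀ y, (y ∉ W → x ∉ W) → hmConst y ∈ hmBasicSet a b W ε := fun y hy =>
    by
    refine lt_of_le_of_lt (measure_mono ?_) hx
    rintro t ⟨ht, htab, hbad⟩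
    exact ⟨ht, htab, hy hbad⟩
  by_cases hxW : x ∈ W
  · exact Filter.mem_of_superset (hW.mem_nhds hxW) fun y hy => hmono y fun h => absurd hy h
  · exact Filter.mem_of_superset Filter.univ_mem fun y _ => hmono y fun _ => hxW

theorem isEmbedding_hmConst {X : Type u} [TopologicalSpace X] :
    IsEmbedding (hmConst : X → HM X) := by
  refine ⟨⟨le_antisymm continuous_hmConst.le_induced fun W hW => ?_⟩, fun x y hxy =>
    congrFun (congrArg Subtype.val hxy) (⟨0, le_rfl, one_pos⟩ : I01)⟩
  refine isOpen_induced_iff.2 ⟨_, isOpen_hmBasicSet (le_refl 0) (le_refl 1) hW (1 - 0), ?_⟩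
  ext x
  exact ⟨mem_of_hmConst_mem_hmBasicSet le_rfl le_rfl,
    fun hx => mem_hmBasicSet_of_forall (by norm_num) fun _ _ => hx⟩

theorem isClosed_range_hmConst {X : Type u} [TopologicalSpace X] [T2Space X] :
    IsClosed (Set.range (hmConst : X → HM X)) := by
  refine ⟨isOpen_iff_mem_nhds.2 fun f hf => ?_⟩
  obtain ⟨s, t, hst⟩ : ∃ s t, f.1 s ≠ f.1 t := by
    by_contra! h
    exact hf ⟨f.1 ⟨0, le_rfl, one_pos⟩, Subtype.ext (funext fun t => h _ t)⟩
  obtain ⟨V, W, hV, hW, hsV, htW, hVW⟩ := t2_separation hst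
  obtain ⟨b, hsb, hb, hfb⟩ := f.2.exists_right_const s
  obtain ⟨d, htd, hd, hfd⟩ := f.2.exists_right_const t
  have hfV : f ∈ hmBasicSet s b V (b - s) :=
    mem_hmBasicSet_of_forall (sub_pos.2 hsb) fun q hq => by rwa [hfb q hq]
  have hfW : f ∈ hmBasicSet t d W (d - t) :=
    mem_hmBasicSet_of_forall (sub_pos.2 htd) fun q hq => by rwa [hfd q hq]
  refine Filter.mem_of_superset (Filter.inter_mem
    ((isOpen_hmBasicSet s.2.1 hb hV _).mem_nhds hfV)
    ((isOpen_hmBasicSet t.2.1 hd hW _).mem_nhds hfW)) ?_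
  rintro _ ⟨hgV, hgW⟩ ⟨x, rfl⟩
  exact Set.disjoint_left.1 hVW (mem_of_hmConst_mem_hmBasicSet s.2.1 hb hgV)
    (mem_of_hmConst_mem_hmBasicSet t.2.1 hd hgW)

theorem isClosedEmbedding_hmConst {X : Type u} [TopologicalSpace X] [T2Space X] :
    IsClosedEmbedding (hmConst : X → HM X) :=
  ⟨isEmbedding_hmConst, isClosed_range_hmConst⟩

theorem isHom_hmConst {E : ℕ → Type u} [∀ n, TopologicalSpace (E n)] (A : EAlg E) :
    IsHom A (HMAlg A) hmConst := fun _ _ _ => rfl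

theorem IsHom.comp {E : ℕ → Type u} [∀ n, TopologicalSpace (E n)] {A B C : EAlg E}
    {h : B.carrier → C.carrier} {k : A.carrier → B.carrier} (hh : IsHom B C h)
    (hk : IsHom A B k) : IsHom A C (h ∘ k) := fun n c x => by
  simp only [Function.comp_apply, hk n c x, hh n c]

/-- If `g ∘ f` is a closed embedding, with `f` and `g` continuous and the intermediate space
Hausdorff, then `f` is a closed embedding. -/
theorem isClosedEmbedding_of_comp_of_t2 {A B C : Type*} [TopologicalSpace A]
    [TopologicalSpace B] [TopologicalSpace C] [T2Space B] {f : A → B} {g : B → C}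
    (hf : Continuous f) (hg : Continuous g) (hgf : IsClosedEmbedding (g ∘ f)) :
    IsClosedEmbedding f :=
  .of_continuous_injective_isClosedMap hf hgf.injective.of_comp
    (isProperMap_of_comp_of_t2 hf hg hgf.isProperMap).isClosedMap

/-- (Theorem 2, closed version) Let `K` be a quasivariety of Hausdorff topological
`ℰ`-algebras, `X` a subspace of `Y` which is an `HM`-valued retract of `Y`, and suppose
`HM(F(X)) ∈ K`.  Then the induced homomorphism `F(e) : F(X) → F(Y)` is a closed
topological embedding. -/
theorem theorem2_closedEmbedding {E : ℕ → Type u} [∀ n, TopologicalSpace (E n)]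
    (K : EAlg E → Prop) (hK : IsQuasivariety K) (hKtop : ∀ A, K A → ContinuousOps A)
    (hKT2 : ∀ A, K A → T2Space A.carrier)
    (Y : Type u) [TopologicalSpace Y] (X : Set Y)
    (FX : EAlg E) (iX : X → FX.carrier) (hFX : IsFreeAlg K X FX iX)
    (FY : EAlg E) (iY : Y → FY.carrier) (hFY : IsFreeAlg K Y FY iY)
    (r : Y → HM X) (hr : Continuous r) (hret : ∀ x : X, r x = hmConst x)
    (hHMF : K (HMAlg FX))
    (Fe : FX.carrier → FY.carrier)
    (hFe : Continuous Fe ∧ IsHom FX FY Fe ∧ ∀ x : X, Fe (iX x) = iY x) :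
    Topology.IsClosedEmbedding Fe := by
  obtain ⟨hFec, hFeh, hFei⟩ := hFe
  obtain ⟨hKFX, hiX, huX⟩ := hFX
  obtain ⟨hKFY, -, huY⟩ := hFY
  have : T2Space FX.carrier := hKT2 FX hKFX
  have : T2Space FY.carrier := hKT2 FY hKFY
  obtain ⟨R, ⟨hRc, hRh, hRi⟩, -⟩ :=
    huY (HMAlg FX) hHMF (fun y => hmMap iX (r y)) ((continuous_hmMap hiX).comp hr)
  have hcomp : R ∘ Fe = hmConst := by
    refine (huX (HMAlg FX) hHMF (fun x => hmConst (iX x)) (continuous_hmConst.comp hiX)).unique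
      ⟨hRc.comp hFec, hRh.comp hFeh, fun x => ?_⟩
      ⟨continuous_hmConst, isHom_hmConst FX, fun _ => rfl⟩
    rw [Function.comp_apply, hFei, hRi, hret]
    rfl
  have hclosed : IsClosedEmbedding (R ∘ Fe) := by
    rw [hcomp]
    exact isClosedEmbedding_hmConst
  exact isClosedEmbedding_of_comp_of_t2 hFec hRc hclosed

end HMPaper
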